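/- Let ω ⊂ ℝ^{n-1} be a bounded convex Lipschitz domain, 0 < α < 1, and η ∈ C^{0,α}(ω̄) with η ≥ η_min > 0, and let Ω_η be the subgraph domain of η. Then the trace map γ_η : u ↦ (x ↦ u(x, η(x))), initially defined on C¹(Ω̄_η) ∩ H¹(Ω_η), satisfies ‖γ_η u‖_{H^s(ω)} ≤ C ‖u‖_{H¹(Ω_η)} for every 0 ≤ s < α/2, with C independent of u; hence γ_η extends to a bounded linear operator H¹(Ω_η) → H^s(ω). -/

import Mathlib

open Set MeasureTheory
open scoped ENNReal

/-- Cauchy–Schwarz for the increment of a `C¹` function along a segment. -/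
theorem ofReal_sq_sub_le_lintegral_fderiv {W : Type*} [NormedAddCommGroup W] [NormedSpace ℝ W]
    {u : W → ℝ} (hu : ContDiff ℝ 1 u) (p v : W) {a b : ℝ} (hab : a ≤ b) :
    ENNReal.ofReal ((u (p + b • v) - u (p + a • v)) ^ 2) ≤
      ENNReal.ofReal ((b - a) * ‖v‖ ^ 2) *
        ∫⁻ t in Ioo a b, ENNReal.ofReal (‖fderiv ℝ u (p + t • v)‖ ^ 2) := by
  have hcu : Continuous (fun t : ℝ => fderiv ℝ u (p + t • v)) :=
    (hu.continuous_fderiv one_ne_zero).comp (by fun_prop)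
  set γ' : ℝ → ℝ := fun t => fderiv ℝ u (p + t • v) v with hγ'
  have hcγ : Continuous γ' := hcu.clm_apply continuous_const
  have hftc : ∫ t in a..b, γ' t = u (p + b • v) - u (p + a • v) := by
    refine intervalIntegral.integral_eq_sub_of_hasDerivAt (f := fun t : ℝ => u (p + t • v))
      (fun t _ => ?_) (hcγ.intervalIntegrable _ _)
    have h1 : HasDerivAt (fun t : ℝ => p + t • v) v t := by
      simpa using ((hasDerivAt_id t).smul_const v).const_add p
    exact ((hu.differentiable one_ne_zero _).hasFDerivAt.comp_hasDerivAt t h1)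
  set Δ := u (p + b • v) - u (p + a • v) with hΔ
  have hCS : Δ ^ 2 ≤ (b - a) * ∫ t in a..b, γ' t ^ 2 := by
    rcases hab.eq_or_lt with rfl | hlt
    · simp [hΔ]
    have hpos : 0 < b - a := sub_pos.2 hlt
    have h0 : 0 ≤ ∫ t in a..b, (γ' t - Δ / (b - a)) ^ 2 :=
      intervalIntegral.integral_nonneg hab fun t _ => sq_nonneg _
    have hexp : ∫ t in a..b, (γ' t - Δ / (b - a)) ^ 2 =
        (∫ t in a..b, γ' t ^ 2) - 2 * (Δ / (b - a)) * Δ + (b - a) * (Δ / (b - a)) ^ 2 := by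
      have : (fun t => (γ' t - Δ / (b - a)) ^ 2) =
          fun t => γ' t ^ 2 - 2 * (Δ / (b - a)) * γ' t + (Δ / (b - a)) ^ 2 := by
        funext t; ring
      rw [this, intervalIntegral.integral_add, intervalIntegral.integral_sub,
        intervalIntegral.integral_const_mul, hftc, intervalIntegral.integral_const, smul_eq_mul]
      all_goals exact Continuous.intervalIntegrable (by fun_prop) _ _
    rw [hexp] at h0
    have : 0 ≤ (b - a) * ((∫ t in a..b, γ' t ^ 2) - 2 * (Δ / (b - a)) * Δ +
        (b - a) * (Δ / (b - a)) ^ 2) := mul_nonneg hpos.le h0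
    have h2 : (b - a) * ((∫ t in a..b, γ' t ^ 2) - 2 * (Δ / (b - a)) * Δ +
        (b - a) * (Δ / (b - a)) ^ 2) = (b - a) * (∫ t in a..b, γ' t ^ 2) - Δ ^ 2 := by
      field_simp; ring
    linarith
  have hle : ∫ t in a..b, γ' t ^ 2 ≤ ∫ t in a..b, ‖v‖ ^ 2 * ‖fderiv ℝ u (p + t • v)‖ ^ 2 := by
    refine intervalIntegral.integral_mono_on hab
      (Continuous.intervalIntegrable (by fun_prop) _ _)
      (Continuous.intervalIntegrable (by fun_prop) _ _) fun t _ => ?_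
    rw [← mul_pow, ← sq_abs, mul_comm ‖v‖]
    exact pow_le_pow_left₀ (abs_nonneg _) ((fderiv ℝ u (p + t • v)).le_opNorm v) 2
  have hcn : Continuous fun t : ℝ => ‖fderiv ℝ u (p + t • v)‖ ^ 2 := by fun_prop
  have hintegral : IntegrableOn (fun t : ℝ => ‖fderiv ℝ u (p + t • v)‖ ^ 2) (Ioo a b) :=
    (hcn.integrableOn_Icc).mono_set Ioo_subset_Icc_self
  rw [← ofReal_integral_eq_lintegral_ofReal hintegral (ae_of_all _ fun t => sq_nonneg _),
    ← ENNReal.ofReal_mul (by have := sub_nonneg.2 hab; positivity)]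
  refine ENNReal.ofReal_le_ofReal (hCS.trans ?_)
  rw [← integral_Ioc_eq_integral_Ioo, ← intervalIntegral.integral_of_le hab, mul_assoc,
    ← intervalIntegral.integral_const_mul (‖v‖ ^ 2)]
  exact mul_le_mul_of_nonneg_left hle (sub_nonneg.2 hab)

/-- `e` dominates the energy density of `f` along vertical and horizontal segments: increments of
`f` along these are controlled by the integral of `e`, as in the Cauchy–Schwarz inequality with
`e = |∇f|²`. -/
structure IsEnergyDensity {E : Type*} [NormedAddCommGroup E] [NormedSpace ℝ E]
    (f : E × ℝ → ℝ) (e : E × ℝ → ℝ≥0∞) : Prop where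
  vertical : ∀ (x : E) (a b : ℝ), a ≤ b → ENNReal.ofReal ((f (x, b) - f (x, a)) ^ 2) ≤
    ENNReal.ofReal (b - a) * ∫⁻ t in Ioo a b, e (x, t)
  horizontal : ∀ (x y : E) (z : ℝ), ENNReal.ofReal ((f (y, z) - f (x, z)) ^ 2) ≤
    ENNReal.ofReal (‖x - y‖ ^ 2) * ∫⁻ t in Ioo (0 : ℝ) 1, e (x + t • (y - x), z)

theorem isEnergyDensity_fderiv {E : Type*} [NormedAddCommGroup E] [NormedSpace ℝ E]
    {u : WithLp 2 (E × ℝ) → ℝ} (hu : ContDiff ℝ 1 u) :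
    IsEnergyDensity (fun p => u (WithLp.toLp 2 p))
      (fun p => ENNReal.ofReal (‖fderiv ℝ u (WithLp.toLp 2 p)‖ ^ 2)) where
  vertical x a b hab := by
    have h := ofReal_sq_sub_le_lintegral_fderiv hu (WithLp.toLp 2 (x, 0))
      (WithLp.toLp 2 ((0 : E), (1 : ℝ))) hab
    have hp : ∀ t : ℝ, WithLp.toLp 2 (x, (0 : ℝ)) + t • WithLp.toLp 2 ((0 : E), (1 : ℝ)) =
        WithLp.toLp 2 (x, t) := fun t => by
      rw [← WithLp.toLp_smul, ← WithLp.toLp_add]; simp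
    simpa only [hp, WithLp.norm_toLp_snd, norm_one, one_pow, mul_one] using h
  horizontal x y z := by
    have h := ofReal_sq_sub_le_lintegral_fderiv hu (WithLp.toLp 2 (x, z))
      (WithLp.toLp 2 (y - x, (0 : ℝ))) zero_le_one
    have hp : ∀ t : ℝ, WithLp.toLp 2 (x, z) + t • WithLp.toLp 2 (y - x, (0 : ℝ)) =
        WithLp.toLp 2 (x + t • (y - x), z) := fun t => by
      rw [← WithLp.toLp_smul, ← WithLp.toLp_add]; simp
    simp only [hp] at h
    simp only [WithLp.norm_toLp_fst, sub_zero, one_mul, one_smul, zero_smul, add_zero,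
      add_sub_cancel] at h
    rwa [norm_sub_rev x y]

/-- The region strictly between the base `ω` and the graph of `η`. -/
def subgraphDomain {E : Type*} (ω : Set E) (η : E → ℝ) : Set (E × ℝ) :=
  {p | p.1 ∈ ω ∧ p.2 ∈ Ioo 0 (η p.1)}

/-- The integral of `e` over the vertical slice of `Ω` above `x`. -/
noncomputable def sliceIntegral {E : Type*} (Ω : Set (E × ℝ)) (e : E × ℝ → ℝ≥0∞) (x : E) : ℝ≥0∞ :=
  ∫⁻ z, Ω.indicator e (x, z)

theorem measurable_sliceIntegral {E : Type*} [MeasurableSpace E] {Ω : Set (E × ℝ)}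
    (hΩ : MeasurableSet Ω) {e : E × ℝ → ℝ≥0∞} (he : Measurable e) :
    Measurable (sliceIntegral Ω e) :=
  (he.indicator hΩ).lintegral_prod_right'

theorem lintegral_sliceIntegral {E : Type*} [MeasureSpace E] {Ω : Set (E × ℝ)}
    (hΩ : MeasurableSet Ω) {e : E × ℝ → ℝ≥0∞} (he : Measurable e) :
    ∫⁻ x, sliceIntegral Ω e x = ∫⁻ p in Ω, e p := by
  rw [← lintegral_indicator hΩ, Measure.volume_eq_prod,
    lintegral_prod _ (he.indicator hΩ).aemeasurable]
  rfl

theorem setLIntegral_le_sliceIntegral {E : Type*} {ω : Set E} {η : E → ℝ} (e : E × ℝ → ℝ≥0∞)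
    {x : E} (hx : x ∈ ω) {a b : ℝ} (ha : 0 ≤ a) (hb : b ≤ η x) :
    ∫⁻ t in Ioo a b, e (x, t) ≤ sliceIntegral (subgraphDomain ω η) e x := by
  rw [← lintegral_indicator measurableSet_Ioo]
  refine lintegral_mono fun z => ?_
  by_cases hz : z ∈ Ioo a b
  · have : (x, z) ∈ subgraphDomain ω η := ⟨hx, ha.trans_lt hz.1, hz.2.trans_le hb⟩
    simp [hz, this]
  · simp [hz]

theorem IsEnergyDensity.ofReal_sq_sub_le_sliceIntegral {E : Type*} [NormedAddCommGroup E]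
    [NormedSpace ℝ E] {f : E × ℝ → ℝ} {e : E × ℝ → ℝ≥0∞} (h : IsEnergyDensity f e) {ω : Set E}
    {η : E → ℝ} {x : E} (hx : x ∈ ω) {z c : ℝ} (hz : 0 ≤ z) (hzη : z ≤ η x) (hc : η x - z ≤ c) :
    ENNReal.ofReal ((f (x, η x) - f (x, z)) ^ 2) ≤
      ENNReal.ofReal c * sliceIntegral (subgraphDomain ω η) e x :=
  (h.vertical x z (η x) hzη).trans
    (mul_le_mul' (ENNReal.ofReal_le_ofReal hc) (setLIntegral_le_sliceIntegral e hx hz le_rfl))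

/-- The trace on the graph is controlled pointwise by the slice integrals. -/
theorem IsEnergyDensity.ofReal_sq_trace_le {E : Type*} [NormedAddCommGroup E]
    [NormedSpace ℝ E] [MeasurableSpace E] {f : E × ℝ → ℝ} {e : E × ℝ → ℝ≥0∞}
    (h : IsEnergyDensity f e)
    {ω : Set E} {η : E → ℝ} {m : ℝ} (hm : 0 < m) {x : E} (hx : x ∈ ω) (hmη : m ≤ η x) :
    ENNReal.ofReal (f (x, η x) ^ 2) ≤ ENNReal.ofReal (2 / m + 2 * m) *
      (sliceIntegral (subgraphDomain ω η) (fun p => ENNReal.ofReal (f p ^ 2)) x +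
        sliceIntegral (subgraphDomain ω η) e x) := by
  set U := sliceIntegral (subgraphDomain ω η) (fun p => ENNReal.ofReal (f p ^ 2)) x with hU
  set G := sliceIntegral (subgraphDomain ω η) e x with hG
  set v := ENNReal.ofReal (f (x, η x) ^ 2) with hv
  have hm' : ENNReal.ofReal m ≠ 0 := by simpa using hm
  have hpt : ∀ z ∈ Ioo (η x - m) (η x),
      v ≤ 2 * (ENNReal.ofReal m * G) + 2 * ENNReal.ofReal (f (x, z) ^ 2) := fun z hz => by
    have h1 := h.ofReal_sq_sub_le_sliceIntegral hx (c := m) (by linarith [hz.1]) hz.2.le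
      (by linarith [hz.1])
    calc v ≤ ENNReal.ofReal (2 * (f (x, η x) - f (x, z)) ^ 2 + 2 * f (x, z) ^ 2) :=
          ENNReal.ofReal_le_ofReal (by nlinarith [sq_nonneg (f (x, η x) - 2 * f (x, z))])
      _ = 2 * ENNReal.ofReal ((f (x, η x) - f (x, z)) ^ 2) + 2 * ENNReal.ofReal (f (x, z) ^ 2) := by
          rw [ENNReal.ofReal_add (by positivity) (by positivity),
            ENNReal.ofReal_mul zero_le_two, ENNReal.ofReal_mul zero_le_two, ENNReal.ofReal_ofNat]
      _ ≤ _ := by gcongr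
  have hintegral : v * ENNReal.ofReal m ≤ 2 * (ENNReal.ofReal m * G) * ENNReal.ofReal m + 2 * U := by
    have hvol : volume (Ioo (η x - m) (η x)) = ENNReal.ofReal m := by
      rw [Real.volume_Ioo]; congr 1; ring
    calc v * ENNReal.ofReal m = ∫⁻ _ in Ioo (η x - m) (η x), v := by
          rw [setLIntegral_const, hvol]
      _ ≤ ∫⁻ z in Ioo (η x - m) (η x),
            (2 * (ENNReal.ofReal m * G) + 2 * ENNReal.ofReal (f (x, z) ^ 2)) :=
          setLIntegral_mono' measurableSet_Ioo hpt
      _ = 2 * (ENNReal.ofReal m * G) * ENNReal.ofReal m +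
            2 * ∫⁻ z in Ioo (η x - m) (η x), ENNReal.ofReal (f (x, z) ^ 2) := by
          rw [lintegral_add_left measurable_const, setLIntegral_const, hvol,
            lintegral_const_mul' _ _ (by simp)]
      _ ≤ _ := by
          gcongr
          exact setLIntegral_le_sliceIntegral (fun p => ENNReal.ofReal (f p ^ 2)) hx
            (by linarith) le_rfl
  have hdiv : v ≤ 2 * (ENNReal.ofReal m * G) + 2 * U / ENNReal.ofReal m := by
    rw [← ENNReal.mul_div_cancel_right hm' ENNReal.ofReal_ne_top
      (a := 2 * (ENNReal.ofReal m * G)), ← ENNReal.add_div]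
    exact (ENNReal.le_div_iff_mul_le (.inl hm') (.inl ENNReal.ofReal_ne_top)).2 hintegral
  have h2m : (2 : ℝ≥0∞) * ENNReal.ofReal m = ENNReal.ofReal (2 * m) := by
    rw [ENNReal.ofReal_mul zero_le_two, ENNReal.ofReal_ofNat]
  have h2d : (2 : ℝ≥0∞) / ENNReal.ofReal m = ENNReal.ofReal (2 / m) := by
    rw [ENNReal.ofReal_div_of_pos hm, ENNReal.ofReal_ofNat]
  calc v ≤ ENNReal.ofReal (2 * m) * G + ENNReal.ofReal (2 / m) * U := by
        rw [← h2m, ← h2d, mul_assoc, mul_comm (2 / ENNReal.ofReal m), ← mul_div_assoc,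
          mul_comm U]
        exact hdiv
    _ ≤ ENNReal.ofReal (2 / m + 2 * m) * G + ENNReal.ofReal (2 / m + 2 * m) * U := by
        gcongr
        · have : 0 < 2 / m := by positivity
          linarith
        · linarith
    _ = _ := by rw [add_comm, mul_add]

/-- Increments of the trace between nearby points: move down from the graph by a distance comparable
to `δ`, move horizontally inside the domain, and move back up, averaging over the height. -/
theorem IsEnergyDensity.ofReal_sq_trace_sub_le {E : Type*} [NormedAddCommGroup E]
    [NormedSpace ℝ E] [MeasurableSpace E] [BorelSpace E]
    {f : E × ℝ → ℝ} {e : E × ℝ → ℝ≥0∞}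
    (h : IsEnergyDensity f e) (he : Measurable e) {ω : Set E} {η : E → ℝ}
    (hΩ : MeasurableSet (subgraphDomain ω η)) (hconv : Convex ℝ ω) {x y : E}
    (hx : x ∈ ω) (hy : y ∈ ω) {δ : ℝ} (hδ : 0 < δ) (hδη : 2 * δ ≤ η x)
    (hosc : ∀ w ∈ segment ℝ x y, |η x - η w| ≤ δ) :
    ENNReal.ofReal ((f (x, η x) - f (y, η y)) ^ 2) ≤
      ENNReal.ofReal (9 * δ) *
        (sliceIntegral (subgraphDomain ω η) e x + sliceIntegral (subgraphDomain ω η) e y) +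
      ENNReal.ofReal (3 * ‖x - y‖ ^ 2 / δ) *
        ∫⁻ t in Ioo (0 : ℝ) 1, sliceIntegral (subgraphDomain ω η) e (x + t • (y - x)) := by
  set Ω := subgraphDomain ω η with hΩdef
  set G := sliceIntegral Ω e with hG
  set w := ENNReal.ofReal ((f (x, η x) - f (y, η y)) ^ 2) with hw
  set J := ∫⁻ t in Ioo (0 : ℝ) 1, G (x + t • (y - x)) with hJ
  have hδ' : ENNReal.ofReal δ ≠ 0 := by simpa using hδ
  have hseg : ∀ t ∈ Ioo (0 : ℝ) 1, x + t • (y - x) ∈ segment ℝ x y := fun t ht => by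
    rw [segment_eq_image']
    exact ⟨t, Ioo_subset_Icc_self ht, rfl⟩
  have hyosc := abs_le.1 (hosc y (right_mem_segment ℝ x y))
  have hpt : ∀ z ∈ Ioo (η x - 2 * δ) (η x - δ), w ≤
      3 * (ENNReal.ofReal (3 * δ) * G x) + 3 * (ENNReal.ofReal (3 * δ) * G y) +
        3 * (ENNReal.ofReal (‖x - y‖ ^ 2) *
          ∫⁻ t in Ioo (0 : ℝ) 1, Ω.indicator e (x + t • (y - x), z)) := fun z hz => by
    have hz0 : 0 < z := by linarith [hz.1]
    have h1 := h.ofReal_sq_sub_le_sliceIntegral hx (c := 3 * δ) hz0.le (by linarith [hz.2])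
      (by linarith [hz.1])
    have h2 := h.ofReal_sq_sub_le_sliceIntegral hy (c := 3 * δ) hz0.le (by linarith [hz.2])
      (by linarith [hz.1])
    have h3 := h.horizontal x y z
    have h4 : ∫⁻ t in Ioo (0 : ℝ) 1, e (x + t • (y - x), z) =
        ∫⁻ t in Ioo (0 : ℝ) 1, Ω.indicator e (x + t • (y - x), z) := by
      refine setLIntegral_congr_fun measurableSet_Ioo fun t ht => ?_
      have hmem : (x + t • (y - x), z) ∈ Ω :=
        ⟨hconv.segment_subset hx hy (hseg t ht), hz0, by
          have := abs_le.1 (hosc _ (hseg t ht))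
          change z < η (x + t • (y - x))
          linarith [hz.2]⟩
      simp [hmem]
    rw [h4] at h3
    calc w ≤ ENNReal.ofReal (3 * (f (x, η x) - f (x, z)) ^ 2 + 3 * (f (y, η y) - f (y, z)) ^ 2 +
            3 * (f (y, z) - f (x, z)) ^ 2) := by
          refine ENNReal.ofReal_le_ofReal ?_
          nlinarith [sq_nonneg ((f (x, η x) - f (x, z)) + (f (y, η y) - f (y, z))),
            sq_nonneg ((f (x, η x) - f (x, z)) + (f (y, z) - f (x, z))),
            sq_nonneg ((f (y, η y) - f (y, z)) - (f (y, z) - f (x, z)))]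
      _ = 3 * ENNReal.ofReal ((f (x, η x) - f (x, z)) ^ 2) +
            3 * ENNReal.ofReal ((f (y, η y) - f (y, z)) ^ 2) +
            3 * ENNReal.ofReal ((f (y, z) - f (x, z)) ^ 2) := by
          have h3' : (0 : ℝ) ≤ 3 := by norm_num
          rw [ENNReal.ofReal_add (by positivity) (by positivity),
            ENNReal.ofReal_add (by positivity) (by positivity),
            ENNReal.ofReal_mul h3', ENNReal.ofReal_mul h3', ENNReal.ofReal_mul h3',
            ENNReal.ofReal_ofNat]
      _ ≤ _ := by gcongr
  have hswap : ∫⁻ z in Ioo (η x - 2 * δ) (η x - δ),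
      ∫⁻ t in Ioo (0 : ℝ) 1, Ω.indicator e (x + t • (y - x), z) ≤ J := by
    refine (setLIntegral_le_lintegral _ _).trans ?_
    rw [lintegral_lintegral_swap]
    · exact le_rfl
    · refine ((he.indicator hΩ).comp (Measurable.prodMk ?_ measurable_fst)).aemeasurable
      exact (show Continuous fun q : ℝ × ℝ => x + q.2 • (y - x) by fun_prop).measurable
  have hintegral : w * ENNReal.ofReal δ ≤
      (3 * (ENNReal.ofReal (3 * δ) * G x) + 3 * (ENNReal.ofReal (3 * δ) * G y)) *
        ENNReal.ofReal δ + 3 * (ENNReal.ofReal (‖x - y‖ ^ 2) * J) := by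
    have hvol : volume (Ioo (η x - 2 * δ) (η x - δ)) = ENNReal.ofReal δ := by
      rw [Real.volume_Ioo]; congr 1; ring
    calc w * ENNReal.ofReal δ = ∫⁻ _ in Ioo (η x - 2 * δ) (η x - δ), w := by
          rw [setLIntegral_const, hvol]
      _ ≤ _ := setLIntegral_mono' measurableSet_Ioo hpt
      _ = _ := by
          rw [lintegral_add_left measurable_const, setLIntegral_const, hvol,
            lintegral_const_mul' _ _ (by simp), lintegral_const_mul' _ _ (by simp)]
      _ ≤ _ := by gcongr
  have hdiv : w ≤ (3 * (ENNReal.ofReal (3 * δ) * G x) + 3 * (ENNReal.ofReal (3 * δ) * G y)) +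
      3 * (ENNReal.ofReal (‖x - y‖ ^ 2) * J) / ENNReal.ofReal δ := by
    rw [← ENNReal.mul_div_cancel_right hδ' ENNReal.ofReal_ne_top
      (a := 3 * (ENNReal.ofReal (3 * δ) * G x) + 3 * (ENNReal.ofReal (3 * δ) * G y)),
      ← ENNReal.add_div]
    exact (ENNReal.le_div_iff_mul_le (.inl hδ') (.inl ENNReal.ofReal_ne_top)).2 hintegral
  refine hdiv.trans_eq ?_
  have h9 : ENNReal.ofReal (9 * δ) = 3 * ENNReal.ofReal (3 * δ) := by
    rw [← ENNReal.ofReal_ofNat, ← ENNReal.ofReal_mul (by norm_num)]; congr 1; ring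
  have hd : ENNReal.ofReal (3 * ‖x - y‖ ^ 2 / δ) =
      3 * ENNReal.ofReal (‖x - y‖ ^ 2) / ENNReal.ofReal δ := by
    rw [ENNReal.ofReal_div_of_pos hδ, ENNReal.ofReal_mul (by norm_num), ENNReal.ofReal_ofNat]
  rw [h9, hd]
  simp only [div_eq_mul_inv]
  ring

/-- The truncated power kernel `‖k‖ ^ r` on the closed unit ball. -/
noncomputable def truncatedPowerKernel {E : Type*} [NormedAddCommGroup E] (r : ℝ) (k : E) : ℝ≥0∞ :=
  (Metric.closedBall (0 : E) 1).indicator (fun k => ENNReal.ofReal (‖k‖ ^ r)) k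

theorem measurable_truncatedPowerKernel {E : Type*} [NormedAddCommGroup E] [MeasurableSpace E]
    [BorelSpace E] (r : ℝ) : Measurable (truncatedPowerKernel r : E → ℝ≥0∞) := by
  refine Measurable.indicator ?_ Metric.isClosed_closedBall.measurableSet
  exact (measurable_norm.pow_const r).ennreal_ofReal

theorem lintegral_truncatedPowerKernel_lt_top {E : Type*} [NormedAddCommGroup E]
    [NormedSpace ℝ E] [FiniteDimensional ℝ E] [MeasureSpace E] [BorelSpace E] [Nontrivial E]
    [(volume : Measure E).IsAddHaarMeasure] {r : ℝ} (hr : -(Module.finrank ℝ E : ℝ) < r) :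
    ∫⁻ k : E, truncatedPowerKernel r k < ∞ := by
  set d := Module.finrank ℝ E with hd
  have hd1 : 1 ≤ d := Module.finrank_pos
  set φ : ℝ → ℝ := (Iic (1 : ℝ)).indicator fun y => y ^ r with hφ
  have hintegral : Integrable (fun k : E => φ ‖k‖) volume := by
    rw [integrable_fun_norm_addHaar, ← hd]
    have hsub : IntegrableOn (fun y : ℝ => y ^ (r + (d - 1 : ℕ))) (Ioc 0 1) := by
      rw [← intervalIntegrable_iff_integrableOn_Ioc_of_le zero_le_one]
      refine intervalIntegral.intervalIntegrable_rpow' ?_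
      rw [Nat.cast_sub hd1]; push_cast; linarith
    have hind : IntegrableOn ((Iic (1 : ℝ)).indicator fun y : ℝ => y ^ (r + (d - 1 : ℕ)))
        (Ioi 0) := by
      rw [IntegrableOn, integrable_indicator_iff measurableSet_Iic, IntegrableOn,
        Measure.restrict_restrict measurableSet_Iic, inter_comm, Ioi_inter_Iic]
      exact hsub
    refine hind.congr_fun (fun y hy => ?_) measurableSet_Ioi
    have hy' : (0 : ℝ) < y := hy
    by_cases h1 : y ≤ 1
    · simp [hφ, h1, Real.rpow_add hy', mul_comm]
    · simp [hφ, h1]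
  refine lt_of_le_of_lt (lintegral_mono fun k => ?_) hintegral.lintegral_lt_top
  by_cases hk : ‖k‖ ≤ 1 <;> simp [truncatedPowerKernel, hφ, hk]

/-- Convolution-type identity behind the horizontal part of the estimate. -/
theorem lintegral_lintegral_kernel_mul_comp_lineMap {E : Type*} [NormedAddCommGroup E]
    [NormedSpace ℝ E] [FiniteDimensional ℝ E] [MeasureSpace E] [BorelSpace E]
    [(volume : Measure E).IsAddHaarMeasure] {φ G : E → ℝ≥0∞} (hφ : Measurable φ)
    (hG : Measurable G) (t : ℝ) :
    ∫⁻ x, ∫⁻ y, φ (x - y) * G (x + t • (y - x)) = (∫⁻ k, φ k) * ∫⁻ x, G x := by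
  have h1 : ∀ x : E, ∫⁻ y, φ (x - y) * G (x + t • (y - x)) = ∫⁻ k, φ k * G (x - t • k) := fun x => by
    rw [← lintegral_sub_left_eq_self (fun k => φ k * G (x - t • k)) x]
    refine lintegral_congr fun y => ?_
    rw [← neg_sub x y, smul_neg, sub_eq_add_neg x (t • _)]
  simp_rw [h1]
  rw [lintegral_lintegral_swap, ← lintegral_mul_const _ hφ]
  · refine lintegral_congr fun k => ?_
    rw [← lintegral_sub_right_eq_self G (t • k)]
    exact lintegral_const_mul _ (hG.comp (measurable_id.sub_const _))
  · refine ((hφ.comp measurable_snd).mul (hG.comp ?_)).aemeasurable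
    exact (show Continuous fun q : E × E => q.1 - t • q.2 by fun_prop).measurable

/-- The kernel-weighted averages of `G` along segments integrate to a multiple of `∫ G`. -/
theorem lintegral_lintegral_kernel_mul_segment {E : Type*} [NormedAddCommGroup E]
    [NormedSpace ℝ E] [FiniteDimensional ℝ E] [MeasureSpace E] [BorelSpace E]
    [(volume : Measure E).IsAddHaarMeasure] {φ G : E → ℝ≥0∞} (hφ : Measurable φ)
    (hG : Measurable G) :
    ∫⁻ x, ∫⁻ y, φ (x - y) * (G x + G y + ∫⁻ t in Ioo (0 : ℝ) 1, G (x + t • (y - x))) =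
      3 * ((∫⁻ k, φ k) * ∫⁻ x, G x) := by
  have hline : Measurable fun q : (E × E) × ℝ => G (q.1.1 + q.2 • (q.1.2 - q.1.1)) :=
    hG.comp (show Continuous fun q : (E × E) × ℝ => q.1.1 + q.2 • (q.1.2 - q.1.1) by
      fun_prop).measurable
  have hker : Measurable fun q : E × E => φ (q.1 - q.2) :=
    hφ.comp (show Continuous fun q : E × E => q.1 - q.2 by fun_prop).measurable
  have hF : Measurable fun q : (E × E) × ℝ =>
      φ (q.1.1 - q.1.2) * G (q.1.1 + q.2 • (q.1.2 - q.1.1)) :=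
    (hker.comp measurable_fst).mul hline
  have hm0 : Measurable fun q : E × E => φ (q.1 - q.2) * G q.1 :=
    hker.mul (hG.comp measurable_fst)
  have hm1 : Measurable fun q : E × E => φ (q.1 - q.2) * G q.2 :=
    hker.mul (hG.comp measurable_snd)
  have h0 : ∫⁻ x, ∫⁻ y, φ (x - y) * G x = (∫⁻ k, φ k) * ∫⁻ x, G x := by
    simpa using lintegral_lintegral_kernel_mul_comp_lineMap hφ hG 0
  have h1 : ∫⁻ x, ∫⁻ y, φ (x - y) * G y = (∫⁻ k, φ k) * ∫⁻ x, G x := by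
    simpa using lintegral_lintegral_kernel_mul_comp_lineMap hφ hG 1
  have h2 : ∫⁻ x, ∫⁻ y, φ (x - y) * ∫⁻ t in Ioo (0 : ℝ) 1, G (x + t • (y - x)) =
      (∫⁻ k, φ k) * ∫⁻ x, G x := by
    calc ∫⁻ x, ∫⁻ y, φ (x - y) * ∫⁻ t in Ioo (0 : ℝ) 1, G (x + t • (y - x))
        = ∫⁻ x, ∫⁻ y, ∫⁻ t in Ioo (0 : ℝ) 1, φ (x - y) * G (x + t • (y - x)) := by
          refine lintegral_congr fun x => lintegral_congr fun y => ?_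
          have hm : Measurable fun t : ℝ => G (x + t • (y - x)) :=
            hline.comp (measurable_prodMk_left (x := (x, y)))
          exact (lintegral_const_mul _ hm).symm
      _ = ∫⁻ x, ∫⁻ t in Ioo (0 : ℝ) 1, ∫⁻ y, φ (x - y) * G (x + t • (y - x)) := by
          refine lintegral_congr fun x => lintegral_lintegral_swap ?_
          exact (hF.comp ((measurable_const.prodMk measurable_fst).prodMk
            measurable_snd)).aemeasurable
      _ = ∫⁻ t in Ioo (0 : ℝ) 1, ∫⁻ x, ∫⁻ y, φ (x - y) * G (x + t • (y - x)) := by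
          refine lintegral_lintegral_swap ?_
          exact (Measurable.lintegral_prod_right' (f := fun q : (E × ℝ) × E =>
            φ (q.1.1 - q.2) * G (q.1.1 + q.1.2 • (q.2 - q.1.1)))
            (hF.comp (((measurable_fst.comp measurable_fst).prodMk measurable_snd).prodMk
              (measurable_snd.comp measurable_fst)))).aemeasurable
      _ = _ := by
          simp_rw [lintegral_lintegral_kernel_mul_comp_lineMap hφ hG]
          simp
  have hadd : ∀ x : E,
      ∫⁻ y, φ (x - y) * (G x + G y + ∫⁻ t in Ioo (0 : ℝ) 1, G (x + t • (y - x))) =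
      (∫⁻ y, φ (x - y) * G x) + (∫⁻ y, φ (x - y) * G y) +
        ∫⁻ y, φ (x - y) * ∫⁻ t in Ioo (0 : ℝ) 1, G (x + t • (y - x)) := fun x => by
    have m0 : Measurable fun y => φ (x - y) * G x := hm0.comp measurable_prodMk_left
    have m1 : Measurable fun y => φ (x - y) * G y := hm1.comp measurable_prodMk_left
    have m01 : Measurable fun y => φ (x - y) * G x + φ (x - y) * G y := m0.add m1
    rw [← lintegral_add_left m0, ← lintegral_add_left m01]
    simp only [mul_add]
  simp_rw [hadd]
  have M0 : Measurable fun x => ∫⁻ y, φ (x - y) * G x := hm0.lintegral_prod_right'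
  have M1 : Measurable fun x => ∫⁻ y, φ (x - y) * G y := hm1.lintegral_prod_right'
  have M01 : Measurable fun x => (∫⁻ y, φ (x - y) * G x) + ∫⁻ y, φ (x - y) * G y := M0.add M1
  rw [lintegral_add_left M01, lintegral_add_left M0, h0, h1, h2]
  ring

/-- Pointwise bound of the Sobolev–Slobodeckij integrand of the trace over a Hölder graph. -/
theorem exists_slobodeckij_integrand_le {E : Type*} [NormedAddCommGroup E]
    [NormedSpace ℝ E] [MeasurableSpace E] [BorelSpace E] {ω : Set E} (hconv : Convex ℝ ω)
    {α L m : ℝ} (hα0 : 0 < α) (hα1 : α < 1) (hL : 0 ≤ L) (hm : 0 < m) {η : E → ℝ}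
    (hΩ : MeasurableSet (subgraphDomain ω η))
    (hHol : ∀ x ∈ ω, ∀ y ∈ ω, |η x - η y| ≤ L * ‖x - y‖ ^ α) (hlb : ∀ x ∈ ω, m ≤ η x)
    {q : ℝ} (hq : 0 ≤ q) :
    ∃ A : ℝ≥0∞, A ≠ ∞ ∧ ∀ (f : E × ℝ → ℝ) (e : E × ℝ → ℝ≥0∞), IsEnergyDensity f e →
      Measurable e → ∀ x ∈ ω, ∀ y ∈ ω,
      ENNReal.ofReal ((f (x, η x) - f (y, η y)) ^ 2 / ‖x - y‖ ^ q) ≤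
        A * (truncatedPowerKernel (α - q) (x - y) *
            (sliceIntegral (subgraphDomain ω η) e x + sliceIntegral (subgraphDomain ω η) e y +
              ∫⁻ t in Ioo (0 : ℝ) 1, sliceIntegral (subgraphDomain ω η) e (x + t • (y - x))) +
          ((sliceIntegral (subgraphDomain ω η) (fun p => ENNReal.ofReal (f p ^ 2)) x +
              sliceIntegral (subgraphDomain ω η) e x) +
            (sliceIntegral (subgraphDomain ω η) (fun p => ENNReal.ofReal (f p ^ 2)) y +
              sliceIntegral (subgraphDomain ω η) e y))) := by
  set K := L + 1 with hK
  have hKpos : 0 < K := by positivity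
  set r₀ := min 1 ((m / (2 * K)) ^ α⁻¹) with hr₀
  have hr₀pos : 0 < r₀ := lt_min one_pos (by positivity)
  have hr₀α : 2 * (K * r₀ ^ α) ≤ m := by
    have h1 : r₀ ^ α ≤ m / (2 * K) := by
      calc r₀ ^ α ≤ ((m / (2 * K)) ^ α⁻¹) ^ α :=
            Real.rpow_le_rpow hr₀pos.le (min_le_right _ _) hα0.le
        _ = m / (2 * K) := Real.rpow_inv_rpow (by positivity) hα0.ne'
    rw [le_div_iff₀ (by positivity)] at h1
    linarith
  refine ⟨ENNReal.ofReal (9 * K) + ENNReal.ofReal (3 / K) +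
    ENNReal.ofReal (2 * r₀ ^ (-q)) * ENNReal.ofReal (2 / m + 2 * m), by finiteness, ?_⟩
  intro f e hfe he x hx y hy
  set G := sliceIntegral (subgraphDomain ω η) e with hG
  set U := sliceIntegral (subgraphDomain ω η) (fun p => ENNReal.ofReal (f p ^ 2)) with hU
  set J := ∫⁻ t in Ioo (0 : ℝ) 1, G (x + t • (y - x)) with hJ
  set D := (f (x, η x) - f (y, η y)) ^ 2 with hD
  rcases eq_or_ne x y with rfl | hxy
  · simp [hD]
  have hh : 0 < ‖x - y‖ := norm_pos_iff.2 (sub_ne_zero.2 hxy)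
  set h := ‖x - y‖ with hh'
  have hsplit : ENNReal.ofReal (D / h ^ q) = ENNReal.ofReal D * ENNReal.ofReal (h ^ (-q)) := by
    rw [← ENNReal.ofReal_mul (sq_nonneg _), Real.rpow_neg hh.le, div_eq_mul_inv]
  rw [hsplit]
  rcases le_or_gt h r₀ with hnear | hfar
  · have hh1 : h ≤ 1 := hnear.trans (min_le_left _ _)
    have hφ : truncatedPowerKernel (α - q) (x - y) = ENNReal.ofReal (h ^ (α - q)) := by
      simp [truncatedPowerKernel, ← hh', hh1]
    have hδ : 0 < K * h ^ α := by positivity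
    have hosc : ∀ w ∈ segment ℝ x y, |η x - η w| ≤ K * h ^ α := fun w hw => by
      refine (hHol x hx w (hconv.segment_subset hx hy hw)).trans ?_
      have hwh : ‖x - w‖ ≤ h := by
        rw [segment_eq_image'] at hw
        obtain ⟨t, ht, rfl⟩ := hw
        have : x - (x + t • (y - x)) = t • (x - y) := by rw [← neg_sub x y, smul_neg]; abel
        rw [this, norm_smul, Real.norm_of_nonneg ht.1]
        exact mul_le_of_le_one_left hh.le ht.2
      exact mul_le_mul (by linarith) (Real.rpow_le_rpow (norm_nonneg _) hwh hα0.le)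
        (by positivity) hKpos.le
    have hδη : 2 * (K * h ^ α) ≤ η x := by
      refine le_trans ?_ (hr₀α.trans (hlb x hx))
      gcongr
    have hmain := hfe.ofReal_sq_trace_sub_le he hΩ hconv hx hy hδ hδη hosc
    rw [← hG, ← hD, ← hJ, ← hh'] at hmain
    have hc1 : ENNReal.ofReal (9 * (K * h ^ α)) * ENNReal.ofReal (h ^ (-q)) =
        ENNReal.ofReal (9 * K) * ENNReal.ofReal (h ^ (α - q)) := by
      rw [← ENNReal.ofReal_mul (by positivity), ← ENNReal.ofReal_mul (by positivity),
        sub_eq_add_neg α q, Real.rpow_add hh]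
      congr 1; ring
    have hc2 : ENNReal.ofReal (3 * h ^ 2 / (K * h ^ α)) * ENNReal.ofReal (h ^ (-q)) ≤
        ENNReal.ofReal (3 / K) * ENNReal.ofReal (h ^ (α - q)) := by
      rw [← ENNReal.ofReal_mul (by positivity), ← ENNReal.ofReal_mul (by positivity)]
      refine ENNReal.ofReal_le_ofReal ?_
      have e1 : 3 * h ^ 2 / (K * h ^ α) * h ^ (-q) = 3 / K * h ^ (2 - α - q) := by
        rw [sub_eq_add_neg (2 - α) q, Real.rpow_add hh, Real.rpow_sub hh, Real.rpow_two]
        field_simp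
      rw [e1]
      exact mul_le_mul_of_nonneg_left
        (Real.rpow_le_rpow_of_exponent_ge hh hh1 (by linarith)) (by positivity)
    rw [hφ]
    calc ENNReal.ofReal D * ENNReal.ofReal (h ^ (-q))
        ≤ (ENNReal.ofReal (9 * (K * h ^ α)) * (G x + G y) +
            ENNReal.ofReal (3 * h ^ 2 / (K * h ^ α)) * J) * ENNReal.ofReal (h ^ (-q)) := by gcongr
      _ = ENNReal.ofReal (9 * (K * h ^ α)) * ENNReal.ofReal (h ^ (-q)) * (G x + G y) +
            ENNReal.ofReal (3 * h ^ 2 / (K * h ^ α)) * ENNReal.ofReal (h ^ (-q)) * J := by ring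
      _ ≤ ENNReal.ofReal (9 * K) * ENNReal.ofReal (h ^ (α - q)) * (G x + G y) +
            ENNReal.ofReal (3 / K) * ENNReal.ofReal (h ^ (α - q)) * J := by
          rw [hc1]; gcongr
      _ = ENNReal.ofReal (9 * K) * (ENNReal.ofReal (h ^ (α - q)) * (G x + G y)) +
            ENNReal.ofReal (3 / K) * (ENNReal.ofReal (h ^ (α - q)) * J) := by ring
      _ ≤ (ENNReal.ofReal (9 * K) + ENNReal.ofReal (3 / K)) *
            (ENNReal.ofReal (h ^ (α - q)) * (G x + G y)) +
          (ENNReal.ofReal (9 * K) + ENNReal.ofReal (3 / K)) *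
            (ENNReal.ofReal (h ^ (α - q)) * J) := by
          gcongr
          · exact le_self_add
          · exact le_add_self
      _ = (ENNReal.ofReal (9 * K) + ENNReal.ofReal (3 / K)) *
            (ENNReal.ofReal (h ^ (α - q)) * (G x + G y + J)) := by ring
      _ ≤ _ := mul_le_mul' le_self_add le_self_add
  · have hx2 := hfe.ofReal_sq_trace_le hm hx (hlb x hx)
    have hy2 := hfe.ofReal_sq_trace_le hm hy (hlb y hy)
    rw [← hU, ← hG] at hx2 hy2
    have hDle : ENNReal.ofReal D ≤
        2 * (ENNReal.ofReal (f (x, η x) ^ 2) + ENNReal.ofReal (f (y, η y) ^ 2)) := by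
      rw [← ENNReal.ofReal_add (sq_nonneg _) (sq_nonneg _), ← ENNReal.ofReal_ofNat,
        ← ENNReal.ofReal_mul zero_le_two]
      exact ENNReal.ofReal_le_ofReal (by nlinarith [sq_nonneg (f (x, η x) + f (y, η y))])
    have hpow : ENNReal.ofReal (h ^ (-q)) ≤ ENNReal.ofReal (r₀ ^ (-q)) :=
      ENNReal.ofReal_le_ofReal
        (Real.rpow_le_rpow_of_nonpos hr₀pos hfar.le (neg_nonpos.2 hq))
    calc ENNReal.ofReal D * ENNReal.ofReal (h ^ (-q))
        ≤ 2 * (ENNReal.ofReal (2 / m + 2 * m) * (U x + G x) +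
            ENNReal.ofReal (2 / m + 2 * m) * (U y + G y)) * ENNReal.ofReal (r₀ ^ (-q)) := by
          gcongr
          exact hDle.trans (by gcongr)
      _ = ENNReal.ofReal (2 * r₀ ^ (-q)) * ENNReal.ofReal (2 / m + 2 * m) *
            ((U x + G x) + (U y + G y)) := by
          rw [ENNReal.ofReal_mul zero_le_two, ENNReal.ofReal_ofNat]; ring
      _ ≤ _ := mul_le_mul' le_add_self le_add_self

/-- `L²` bound for the trace on a graph. -/
theorem IsEnergyDensity.lintegral_sq_trace_le {E : Type*} [NormedAddCommGroup E]
    [NormedSpace ℝ E] [MeasureSpace E] {f : E × ℝ → ℝ} {e : E × ℝ → ℝ≥0∞}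
    (h : IsEnergyDensity f e) (hf : Measurable f) (he : Measurable e)
    {ω : Set E} (hω : MeasurableSet ω) {η : E → ℝ}
    (hΩ : MeasurableSet (subgraphDomain ω η)) {m : ℝ} (hm : 0 < m) (hlb : ∀ x ∈ ω, m ≤ η x) :
    ∫⁻ x in ω, ENNReal.ofReal (f (x, η x) ^ 2) ≤ ENNReal.ofReal (2 / m + 2 * m) *
      ((∫⁻ p in subgraphDomain ω η, ENNReal.ofReal (f p ^ 2)) +
        ∫⁻ p in subgraphDomain ω η, e p) := by
  have hf2 : Measurable fun p => ENNReal.ofReal (f p ^ 2) := (hf.pow_const 2).ennreal_ofReal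
  rw [← lintegral_sliceIntegral hΩ hf2, ← lintegral_sliceIntegral hΩ he,
    ← lintegral_add_left (measurable_sliceIntegral hΩ hf2),
    ← lintegral_const_mul' _ _ ENNReal.ofReal_ne_top]
  exact (setLIntegral_mono' hω fun x hx => h.ofReal_sq_trace_le hm hx (hlb x hx)).trans
    (setLIntegral_le_lintegral _ _)

/-- Bound of the Sobolev–Slobodeckij seminorm of order `s < α / 2` of the trace on the graph of an
`α`-Hölder function. -/
theorem exists_slobodeckij_trace_le {E : Type*} [NormedAddCommGroup E]
    [NormedSpace ℝ E] [FiniteDimensional ℝ E] [Nontrivial E] [MeasureSpace E] [BorelSpace E]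
    [(volume : Measure E).IsAddHaarMeasure] {ω : Set E} (hω : MeasurableSet ω)
    (hconv : Convex ℝ ω) (hvol : volume ω ≠ ∞)
    {α L m : ℝ} (hα0 : 0 < α) (hα1 : α < 1) (hL : 0 ≤ L) (hm : 0 < m) {η : E → ℝ}
    (hΩ : MeasurableSet (subgraphDomain ω η))
    (hHol : ∀ x ∈ ω, ∀ y ∈ ω, |η x - η y| ≤ L * ‖x - y‖ ^ α) (hlb : ∀ x ∈ ω, m ≤ η x)
    {s : ℝ} (hs : 0 ≤ s) (hsα : s < α / 2) :
    ∃ C : ℝ≥0∞, C ≠ ∞ ∧ ∀ (f : E × ℝ → ℝ) (e : E × ℝ → ℝ≥0∞), IsEnergyDensity f e →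
      Measurable f → Measurable e →
      ∫⁻ x in ω, ∫⁻ y in ω,
        ENNReal.ofReal ((f (x, η x) - f (y, η y)) ^ 2 /
          ‖x - y‖ ^ ((Module.finrank ℝ E : ℝ) + 2 * s)) ≤
      C * ((∫⁻ p in subgraphDomain ω η, ENNReal.ofReal (f p ^ 2)) +
        ∫⁻ p in subgraphDomain ω η, e p) := by
  set q := (Module.finrank ℝ E : ℝ) + 2 * s with hq
  obtain ⟨A, hA, hbound⟩ := exists_slobodeckij_integrand_le hconv hα0 hα1 hL hm hΩ hHol hlb
    (q := q) (by positivity)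
  set φ : E → ℝ≥0∞ := truncatedPowerKernel (α - q) with hφ
  have hφm : Measurable φ := measurable_truncatedPowerKernel _
  have hφfin : ∫⁻ k, φ k ≠ ∞ :=
    (lintegral_truncatedPowerKernel_lt_top (by rw [hq]; linarith)).ne
  refine ⟨A * (3 * (∫⁻ k, φ k) + 2 * volume ω), by finiteness, ?_⟩
  intro f e hfe hf he
  have hf2 : Measurable fun p => ENNReal.ofReal (f p ^ 2) := (hf.pow_const 2).ennreal_ofReal
  rw [← lintegral_sliceIntegral hΩ hf2, ← lintegral_sliceIntegral hΩ he]
  replace hbound := hbound f e hfe he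
  have hG := measurable_sliceIntegral hΩ he
  have hU := measurable_sliceIntegral hΩ hf2
  set G := sliceIntegral (subgraphDomain ω η) e
  set U := sliceIntegral (subgraphDomain ω η) (fun p => ENNReal.ofReal (f p ^ 2))
  rw [← lintegral_add_left hU]
  set P : E → E → ℝ≥0∞ := fun x y =>
    φ (x - y) * (G x + G y + ∫⁻ t in Ioo (0 : ℝ) 1, G (x + t • (y - x))) with hP
  have hH : Measurable fun x => U x + G x := hU.add hG
  have hfar : ∀ x, ∫⁻ y in ω, ((U x + G x) + (U y + G y)) ≤
      (U x + G x) * volume ω + ∫⁻ y, (U y + G y) := fun x => by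
    rw [lintegral_add_left measurable_const, setLIntegral_const]
    gcongr
    exact Measure.restrict_le_self
  have hfar2 : ∫⁻ x in ω, ∫⁻ y in ω, ((U x + G x) + (U y + G y)) ≤
      2 * volume ω * ∫⁻ y, (U y + G y) := by
    calc _ ≤ ∫⁻ x in ω, ((U x + G x) * volume ω + ∫⁻ y, (U y + G y)) :=
          lintegral_mono hfar
      _ = (∫⁻ x in ω, (U x + G x)) * volume ω + (∫⁻ y, (U y + G y)) * volume ω := by
          rw [lintegral_add_right _ measurable_const, setLIntegral_const,
            lintegral_mul_const _ hH]
      _ ≤ (∫⁻ x, (U x + G x)) * volume ω + (∫⁻ y, (U y + G y)) * volume ω := by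
          gcongr
          exact Measure.restrict_le_self
      _ = _ := by ring
  have hnear : ∫⁻ x in ω, ∫⁻ y in ω, P x y ≤ 3 * (∫⁻ k, φ k) * ∫⁻ y, (U y + G y) := by
    calc _ ≤ ∫⁻ x, ∫⁻ y, P x y :=
          (setLIntegral_le_lintegral _ _).trans
            (lintegral_mono fun x => setLIntegral_le_lintegral _ _)
      _ = 3 * ((∫⁻ k, φ k) * ∫⁻ x, G x) := lintegral_lintegral_kernel_mul_segment hφm hG
      _ ≤ 3 * ((∫⁻ k, φ k) * ∫⁻ y, (U y + G y)) := by
          gcongr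
          exact le_add_self
      _ = _ := by ring
  calc _ ≤ ∫⁻ x in ω, ∫⁻ y in ω, A * (P x y + ((U x + G x) + (U y + G y))) :=
        setLIntegral_mono' hω fun x hx => setLIntegral_mono' hω fun y hy => hbound x hx y hy
    _ = A * ((∫⁻ x in ω, ∫⁻ y in ω, P x y) +
          ∫⁻ x in ω, ∫⁻ y in ω, ((U x + G x) + (U y + G y))) := by
        have hF : Measurable fun p : E × E => (U p.1 + G p.1) + (U p.2 + G p.2) :=
          (hH.comp measurable_fst).add (hH.comp measurable_snd)
        rw [← lintegral_add_right _ hF.lintegral_prod_right',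
          ← lintegral_const_mul' _ _ hA]
        refine lintegral_congr fun x => ?_
        have hFx : Measurable fun y => (U x + G x) + (U y + G y) :=
          hF.comp (measurable_prodMk_left (x := x))
        rw [lintegral_const_mul' _ _ hA, lintegral_add_right _ hFx]
    _ ≤ A * (3 * (∫⁻ k, φ k) * (∫⁻ y, (U y + G y)) +
          2 * volume ω * ∫⁻ y, (U y + G y)) := by gcongr
    _ = _ := by ring

theorem isOpen_subgraphDomain {E : Type*} [TopologicalSpace E] {ω : Set E} (hω : IsOpen ω)
    {η : E → ℝ} (hη : ContinuousOn η ω) : IsOpen (subgraphDomain ω η) := by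
  have hc : ContinuousOn (fun p : E × ℝ => η p.1 - p.2) (ω ×ˢ Ioi 0) :=
    (hη.comp continuousOn_fst fun p hp => hp.1).sub continuousOn_snd
  have h := hc.isOpen_inter_preimage (hω.prod isOpen_Ioi) (isOpen_Ioi (a := (0 : ℝ)))
  convert h using 1
  ext p
  simp [subgraphDomain, and_assoc]

theorem continuousOn_of_holder_bound {E : Type*} [NormedAddCommGroup E] {ω : Set E}
    {η : E → ℝ} {L α : ℝ} (hα : 0 < α)
    (hHol : ∀ x ∈ ω, ∀ y ∈ ω, |η x - η y| ≤ L * ‖x - y‖ ^ α) : ContinuousOn η ω := by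
  intro x hx
  rw [ContinuousWithinAt, tendsto_iff_norm_sub_tendsto_zero]
  have hlim : Filter.Tendsto (fun y => L * ‖y - x‖ ^ α) (nhdsWithin x ω) (nhds 0) := by
    have : Continuous fun y => L * ‖y - x‖ ^ α :=
      continuous_const.mul ((continuous_id.sub continuous_const).norm.rpow_const
        fun _ => .inr hα.le)
    have h := this.tendsto x
    simp only [sub_self, norm_zero, Real.zero_rpow hα.ne', mul_zero] at h
    exact h.mono_left nhdsWithin_le_nhds
  refine squeeze_zero' (.of_forall fun _ => norm_nonneg _) ?_ hlim
  filter_upwards [self_mem_nhdsWithin] with y hy using hHol y hy x hx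

theorem isBounded_subgraphDomain {E : Type*} [NormedAddCommGroup E] {ω : Set E}
    (hω : Bornology.IsBounded ω) {η : E → ℝ} {L α : ℝ} (hα : 0 < α) (hL : 0 ≤ L)
    (hHol : ∀ x ∈ ω, ∀ y ∈ ω, |η x - η y| ≤ L * ‖x - y‖ ^ α) :
    Bornology.IsBounded (subgraphDomain ω η) := by
  rcases ω.eq_empty_or_nonempty with rfl | ⟨x₀, hx₀⟩
  · simp [subgraphDomain]
  obtain ⟨R, hR⟩ := hω.exists_norm_le
  refine (hω.prod (Metric.isBounded_Icc (0 : ℝ) (η x₀ + L * (2 * R) ^ α))).subset ?_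
  rintro ⟨x, z⟩ ⟨hx, hz0, hzη⟩
  refine ⟨hx, le_of_lt hz0, ?_⟩
  have h1 := (abs_le.1 (hHol x hx x₀ hx₀)).2
  have h2 : L * ‖x - x₀‖ ^ α ≤ L * (2 * R) ^ α := by
    refine mul_le_mul_of_nonneg_left (Real.rpow_le_rpow (norm_nonneg _) ?_ hα.le) hL
    linarith [norm_sub_le x x₀, hR x hx, hR x₀ hx₀]
  change z < η x at hzη
  change z ≤ η x₀ + L * (2 * R) ^ α
  linarith

theorem ofReal_setIntegral_eq_of_continuous {X : Type*} [MetricSpace X] [ProperSpace X]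
    [MeasureSpace X] [OpensMeasurableSpace X]
    [IsFiniteMeasureOnCompacts (volume : Measure X)]
    {g : X → ℝ} (hg : Continuous g) (hg0 : ∀ p, 0 ≤ g p) {Ω : Set X}
    (hΩ : Bornology.IsBounded Ω) :
    ENNReal.ofReal (∫ p in Ω, g p) = ∫⁻ p in Ω, ENNReal.ofReal (g p) :=
  ofReal_integral_eq_lintegral_ofReal
    ((hg.continuousOn.integrableOn_compact hΩ.isCompact_closure).mono_set subset_closure)
    (ae_of_all _ hg0)

theorem ofReal_integral_le_lintegral {X : Type*} [MeasurableSpace X] {μ : Measure X} {g : X → ℝ}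
    (hg : ∀ x, 0 ≤ g x) : ENNReal.ofReal (∫ x, g x ∂μ) ≤ ∫⁻ x, ENNReal.ofReal (g x) ∂μ := by
  have h := enorm_integral_le_lintegral_enorm (μ := μ) g
  rw [Real.enorm_eq_ofReal (integral_nonneg hg)] at h
  simpa only [Real.enorm_eq_ofReal (hg _)] using h

/-- the trace estimate `‖γ_η u‖_{H^s(ω)} ≤ C ‖u‖_{H¹(Ω_η)}` for all
`0 ≤ s < α/2`, for `u` of class `C¹` up to the closure (here: globally `C¹`), where the
`H^s` norm is the Sobolev–Slobodeckij norm (`H⁰ = L²`). -/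
theorem stmt13 (n : ℕ) (hn : 2 ≤ n) (ω : Set (EuclideanSpace ℝ (Fin (n - 1))))
    (hopen : IsOpen ω) (hconv : Convex ℝ ω) (hbdd : Bornology.IsBounded ω)
    (α L ηmin : ℝ) (hα0 : 0 < α) (hα1 : α < 1) (hL : 0 ≤ L) (hηmin : 0 < ηmin)
    (η : EuclideanSpace ℝ (Fin (n - 1)) → ℝ)
    (hHol : ∀ x ∈ closure ω, ∀ y ∈ closure ω, |η x - η y| ≤ L * ‖x - y‖ ^ α)
    (hlb : ∀ x ∈ closure ω, ηmin ≤ η x) :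
    ∀ s : ℝ, 0 ≤ s → s < α / 2 →
    ∃ C > 0, ∀ u : WithLp 2 (EuclideanSpace ℝ (Fin (n - 1)) × ℝ) → ℝ, ContDiff ℝ 1 u →
      Real.sqrt
        ((∫ x in ω,
            (u ((WithLp.equiv 2 (EuclideanSpace ℝ (Fin (n - 1)) × ℝ)).symm (x, η x))) ^ 2) +
          (if s = 0 then 0 else
            ∫ x₁ in ω, ∫ x₂ in ω,
              (u ((WithLp.equiv 2 (EuclideanSpace ℝ (Fin (n - 1)) × ℝ)).symm (x₁, η x₁)) -
                u ((WithLp.equiv 2 (EuclideanSpace ℝ (Fin (n - 1)) × ℝ)).symm (x₂, η x₂))) ^ 2 /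
                ‖x₁ - x₂‖ ^ (((n:ℝ) - 1) + 2*s))) ≤
      C * Real.sqrt
        ((∫ p in {p : EuclideanSpace ℝ (Fin (n - 1)) × ℝ | p.1 ∈ ω ∧ p.2 ∈ Ioo 0 (η p.1)},
            (u ((WithLp.equiv 2 (EuclideanSpace ℝ (Fin (n - 1)) × ℝ)).symm p)) ^ 2) +
          ∫ p in {p : EuclideanSpace ℝ (Fin (n - 1)) × ℝ | p.1 ∈ ω ∧ p.2 ∈ Ioo 0 (η p.1)},
            ‖gradient u ((WithLp.equiv 2 (EuclideanSpace ℝ (Fin (n - 1)) × ℝ)).symm p)‖ ^ 2) := by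
  
  intro s hs hsα
  have hsub : ω ⊆ closure ω := subset_closure
  have hHol' : ∀ x ∈ ω, ∀ y ∈ ω, |η x - η y| ≤ L * ‖x - y‖ ^ α :=
    fun x hx y hy => hHol x (hsub hx) y (hsub hy)
  have hlb' : ∀ x ∈ ω, ηmin ≤ η x := fun x hx => hlb x (hsub hx)
  have hΩ : MeasurableSet (subgraphDomain ω η) :=
    (isOpen_subgraphDomain hopen (continuousOn_of_holder_bound hα0 hHol')).measurableSet
  have hΩb : Bornology.IsBounded (subgraphDomain ω η) :=
    isBounded_subgraphDomain hbdd hα0 hL hHol'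
  have : Nonempty (Fin (n - 1)) := ⟨⟨0, by omega⟩⟩
  obtain ⟨C, hC, hslob⟩ := exists_slobodeckij_trace_le hopen.measurableSet hconv
    hbdd.measure_lt_top.ne hα0 hα1 hL hηmin hΩ hHol' hlb' hs hsα
  have hdim : (Module.finrank ℝ (EuclideanSpace ℝ (Fin (n - 1))) : ℝ) = (n : ℝ) - 1 := by
    rw [finrank_euclideanSpace_fin, Nat.cast_sub (by omega), Nat.cast_one]
  rw [hdim] at hslob
  set B := 2 / ηmin + 2 * ηmin with hB
  have hBpos : 0 < B := by positivity
  refine ⟨Real.sqrt (B + C.toReal), by positivity, fun u hu => ?_⟩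
  rw [← Real.sqrt_mul (by positivity)]
  refine Real.sqrt_le_sqrt ?_
  have hfe := isEnergyDensity_fderiv hu
  have hcont : Continuous fun p : EuclideanSpace ℝ (Fin (n - 1)) × ℝ => u (WithLp.toLp 2 p) :=
    hu.continuous.comp (WithLp.prod_continuous_toLp 2 _ _)
  have hcontD : Continuous fun p : EuclideanSpace ℝ (Fin (n - 1)) × ℝ =>
      ‖fderiv ℝ u (WithLp.toLp 2 p)‖ ^ 2 :=
    (((hu.continuous_fderiv one_ne_zero).comp (WithLp.prod_continuous_toLp 2 _ _)).norm).pow 2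
  have htrace := hfe.lintegral_sq_trace_le hcont.measurable hcontD.measurable.ennreal_ofReal
    hopen.measurableSet hΩ hηmin hlb'
  have hsem := hslob _ _ hfe hcont.measurable hcontD.measurable.ennreal_ofReal
  have hgrad : ∀ p, ‖gradient u p‖ = ‖fderiv ℝ u p‖ := fun p => by
    rw [gradient, LinearIsometryEquiv.norm_map]
  have hsq : ∀ p : EuclideanSpace ℝ (Fin (n - 1)) × ℝ, 0 ≤ u (WithLp.toLp 2 p) ^ 2 :=
    fun p => sq_nonneg _
  have hcont2 : Continuous fun p : EuclideanSpace ℝ (Fin (n - 1)) × ℝ =>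
      u (WithLp.toLp 2 p) ^ 2 := hcont.pow 2
  rw [← ofReal_setIntegral_eq_of_continuous hcont2 hsq hΩb,
    ← ofReal_setIntegral_eq_of_continuous hcontD (fun p => sq_nonneg _) hΩb,
    ← ENNReal.ofReal_add (integral_nonneg hsq) (integral_nonneg fun p => sq_nonneg _)]
    at htrace hsem
  simp only [WithLp.equiv_symm_apply, hgrad]
  change _ ≤ (B + C.toReal) * ((∫ p in subgraphDomain ω η, u (WithLp.toLp 2 p) ^ 2) +
    ∫ p in subgraphDomain ω η, ‖fderiv ℝ u (WithLp.toLp 2 p)‖ ^ 2)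
  set N := (∫ p in subgraphDomain ω η, u (WithLp.toLp 2 p) ^ 2) +
    ∫ p in subgraphDomain ω η, ‖fderiv ℝ u (WithLp.toLp 2 p)‖ ^ 2
  have hN : 0 ≤ N := add_nonneg (integral_nonneg hsq) (integral_nonneg fun p => sq_nonneg _)
  rw [add_mul]
  refine add_le_add ?_ ?_
  · rw [← ENNReal.ofReal_le_ofReal_iff (by positivity), ENNReal.ofReal_mul hBpos.le]
    exact (ofReal_integral_le_lintegral fun x => sq_nonneg _).trans htrace
  · split_ifs with hs0
    · positivity
    rw [← ENNReal.ofReal_le_ofReal_iff (by positivity),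
      ENNReal.ofReal_mul ENNReal.toReal_nonneg, ENNReal.ofReal_toReal hC]
    refine le_trans ?_ hsem
    refine (ofReal_integral_le_lintegral fun x => integral_nonneg fun y => by positivity).trans ?_
    exact lintegral_mono fun x => ofReal_integral_le_lintegral fun y => by positivity
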